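/- Let M = (Ω, P) be a canonical partially observable Markov chain with sink s, and let 𝒫 be a partition of Ω in which {s} is a class. Define θ(𝒫) = max{ d_TV^𝒫(x,y) : x, y ∈ Ω, 𝒫(x) = 𝒫(y) }. Then for all states a, b ∈ Ω with 𝒫(a) = 𝒫(b), every rewinding strategy A and every T ∈ ℕ satisfy d_TV(D_T^{A,a}, D_T^{A,b}) ≤ T · θ(𝒫); consequently, any rewinding strategy making Q queries correctly identifies a uniformly random hidden initial state from {a, b} with probability at most 1/2 + Q·θ(𝒫)/2. -/

import Mathlib

open Finset
open scoped ENNReal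

/-- A canonical partially observable Markov chain: a finite state space with a
distinguished absorbing sink state; `P x y` is the probability of moving from `x` to `y`. -/
structure Canonical (Ω : Type) [Fintype Ω] [DecidableEq Ω] where
  P : Ω → Ω → ℝ
  sink : Ω
  nonneg : ∀ x y, 0 ≤ P x y
  sum_one : ∀ x, ∑ y, P x y = 1
  sink_absorb : P sink sink = 1

variable {Ω : Type} [Fintype Ω] [DecidableEq Ω]

/-- Observation: `true` iff the state is the sink. -/
def Canonical.obs (M : Canonical Ω) (x : Ω) : Bool := decide (x = M.sink)

/-- The observation history `Z₀, …, Z_t` of a state trajectory `g`. -/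
def obsHist (M : Canonical Ω) (g : ℕ → Ω) (t : ℕ) : List Bool :=
  (List.range (t + 1)).map fun i => M.obs (g i)

/-- Probability of the state trajectory `g` (conditionally on its initial state `g 0`)
under rewinding strategy `A`, for `T` steps: at each time `t`, the next state `g (t+1)` is
drawn from the state at time `t - A(Z₀,…,Z_t)` (truncated subtraction realizes `max 0 _`). -/
noncomputable def trajProb (M : Canonical Ω) (A : List Bool → ℕ) (T : ℕ) (g : ℕ → Ω) : ℝ :=
  ∏ t ∈ Finset.range T, M.P (g (t - A (obsHist M g t))) (g (t + 1))

/-- Extend `f : Fin (T+1) → Ω` to `ℕ → Ω` by clamping. -/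
def extendTraj {Ω : Type} (T : ℕ) (f : Fin (T + 1) → Ω) : ℕ → Ω :=
  fun n => f ⟨min n T, Nat.lt_succ_of_le (min_le_right n T)⟩

/-- The probability that the chain `M` with rewinding strategy `A`, started at `x`,
produces the observation sequence `z = (Z₀, …, Z_T)`.  This is the distribution `D_T^{A,x}`. -/
noncomputable def obsSeqProb (M : Canonical Ω) (A : List Bool → ℕ) (x : Ω) (T : ℕ)
    (z : Fin (T + 1) → Bool) : ℝ :=
  ∑ f : Fin (T + 1) → Ω,
    if f 0 = x ∧ (∀ i, M.obs (f i) = z i) then trajProb M A T (extendTraj T f) else 0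

/-- Total variation distance between the observation-sequence distributions
`D_T^{A,a}` and `D_T^{A,b}`. -/
noncomputable def obsTV (M : Canonical Ω) (A : List Bool → ℕ) (a b : Ω) (T : ℕ) : ℝ :=
  (1 / 2) * ∑ z : Fin (T + 1) → Bool, |obsSeqProb M A a T z - obsSeqProb M A b T z|

/-- A rewinding strategy is non-adaptive if it depends only on the length of the history. -/
def NonAdaptive (A : List Bool → ℕ) : Prop :=
  ∀ l₁ l₂ : List Bool, l₁.length = l₂.length → A l₁ = A l₂

/-- Query complexity `QC^A_M(a,b)`: the least `T` with `d_TV(D_T^{A,a}, D_T^{A,b}) ≥ 1/3`,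
as an element of `ℝ≥0∞` (`⊤` if no such `T` exists). -/
noncomputable def QC (M : Canonical Ω) (A : List Bool → ℕ) (a b : Ω) : ℝ≥0∞ :=
  sInf {x : ℝ≥0∞ | ∃ T : ℕ, x = (T : ℝ≥0∞) ∧ 1 / 3 ≤ obsTV M A a b T}

/-- Adaptive query complexity: infimum over all rewinding strategies. -/
noncomputable def AQC (M : Canonical Ω) (a b : Ω) : ℝ≥0∞ :=
  ⨅ A : List Bool → ℕ, QC M A a b

/-- Non-adaptive query complexity: infimum over all non-adaptive rewinding strategies. -/
noncomputable def NAQC (M : Canonical Ω) (a b : Ω) : ℝ≥0∞ :=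
  ⨅ A : {A : List Bool → ℕ // NonAdaptive A}, QC M A.1 a b
/-- A partition of a finite type `Ω`, given by the map sending each element to its class. -/
structure Partn (Ω : Type) [Fintype Ω] [DecidableEq Ω] where
  cls : Ω → Finset Ω
  mem_cls : ∀ x, x ∈ cls x
  cls_eq : ∀ x y, y ∈ cls x → cls y = cls x

/-- `probOf P x C = P(C|x)`, the probability that the next state after `x` lies in `C`. -/
noncomputable def probOf {Ω : Type} [Fintype Ω] (P : Ω → Ω → ℝ) (x : Ω) (C : Finset Ω) : ℝ :=
  ∑ y ∈ C, P x y

/-- Projected total variation distance `d_TV^Pt(a,b)`. -/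
noncomputable def dTVP {Ω : Type} [Fintype Ω] [DecidableEq Ω] (P : Ω → Ω → ℝ)
    (Pt : Partn Ω) (a b : Ω) : ℝ :=
  (1 / 2) * ∑ C ∈ Finset.univ.image Pt.cls, |probOf P a C - probOf P b C|

/-- `Pt'` refines `Pt` if every class of `Pt'` is contained in a class of `Pt`. -/
def Refines {Ω : Type} [Fintype Ω] [DecidableEq Ω] (Pt' Pt : Partn Ω) : Prop :=
  ∀ x, Pt'.cls x ⊆ Pt.cls x

/-- The weight `w(Pt,Pt')`: the maximum of `1/d_TV^Pt(x,y)²` over pairs `x, y` lying in the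
same class of `Pt` but different classes of `Pt'` (valued in `ℝ≥0∞`; `1/0 = ⊤`). -/
noncomputable def wgt {Ω : Type} [Fintype Ω] [DecidableEq Ω] (P : Ω → Ω → ℝ)
    (Pt Pt' : Partn Ω) : ℝ≥0∞ :=
  ⨆ (x : Ω) (y : Ω) (_ : Pt.cls x = Pt.cls y ∧ Pt'.cls x ≠ Pt'.cls y),
    (ENNReal.ofReal ((dTVP P Pt x y) ^ 2))⁻¹

lemma extendTraj_snoc_of_le {α : Type} {T n : ℕ} (f : Fin (T + 1) → α) (y : α) (h : n ≤ T) :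
    extendTraj (T + 1) (Fin.snoc f y : Fin (T + 2) → α) n = extendTraj T f n := by
  have e : (⟨min n (T + 1), Nat.lt_succ_of_le (min_le_right n (T + 1))⟩ : Fin (T + 2)) =
      Fin.castSucc ⟨min n T, Nat.lt_succ_of_le (min_le_right n T)⟩ := by
    ext; simp; omega
  unfold extendTraj
  rw [e]
  exact Fin.snoc_castSucc (α := fun _ => α) y f _

lemma extendTraj_snoc_last {α : Type} {T : ℕ} (f : Fin (T + 1) → α) (y : α) :
    extendTraj (T + 1) (Fin.snoc f y : Fin (T + 2) → α) (T + 1) = y := by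
  have e : (⟨min (T + 1) (T + 1), Nat.lt_succ_of_le (min_le_right (T + 1) (T + 1))⟩ :
      Fin (T + 2)) = Fin.last (T + 1) := by
    ext; simp
  unfold extendTraj
  rw [e]
  exact Fin.snoc_last (α := fun _ => α) y f

lemma extendTraj_comp {α β : Type} (T : ℕ) (f : Fin (T + 1) → α) (φ : α → β) (n : ℕ) :
    extendTraj T (fun i => φ (f i)) n = φ (extendTraj T f n) := rfl

lemma obsHist_congr (M : Canonical Ω) {g g' : ℕ → Ω} {t : ℕ} (h : ∀ i ≤ t, g i = g' i) :
    obsHist M g t = obsHist M g' t := by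
  unfold obsHist
  refine List.map_congr_left fun i hi => ?_
  rw [h i (by have := List.mem_range.1 hi; omega)]

lemma trajProb_nonneg (M : Canonical Ω) (A : List Bool → ℕ) (T : ℕ) (g : ℕ → Ω) :
    0 ≤ trajProb M A T g :=
  Finset.prod_nonneg fun _ _ => M.nonneg _ _

lemma trajProb_snoc (M : Canonical Ω) (A : List Bool → ℕ) (T : ℕ) (f : Fin (T + 1) → Ω)
    (y : Ω) :
    trajProb M A (T + 1) (extendTraj (T + 1) (Fin.snoc f y : Fin (T + 2) → Ω)) =
      trajProb M A T (extendTraj T f) *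
        M.P (extendTraj T f (T - A (obsHist M (extendTraj T f) T))) y := by
  have hist : ∀ t ≤ T, obsHist M (extendTraj (T + 1) (Fin.snoc f y : Fin (T + 2) → Ω)) t =
      obsHist M (extendTraj T f) t := fun t ht =>
    obsHist_congr M fun i hi => extendTraj_snoc_of_le f y (hi.trans ht)
  unfold trajProb
  rw [Finset.prod_range_succ]
  congr 1
  · refine Finset.prod_congr rfl fun t ht => ?_
    have ht' := Finset.mem_range.1 ht
    rw [hist t ht'.le, extendTraj_snoc_of_le f y (by omega),
      extendTraj_snoc_of_le f y (by omega)]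
  · rw [hist T le_rfl, extendTraj_snoc_of_le f y (by omega), extendTraj_snoc_last]

lemma sum_snoc {α : Type} [Fintype α] (T : ℕ) (F : (Fin (T + 2) → α) → ℝ) :
    ∑ f, F f = ∑ f : Fin (T + 1) → α, ∑ y, F (Fin.snoc f y : Fin (T + 2) → α) := by
  rw [← (Fin.snocEquiv fun _ : Fin (T + 2) => α).sum_comp F, Fintype.sum_prod_type,
    Finset.sum_comm]
  rfl

/-- Two mixtures of pairwise close distributions are close, up to the difference of their
total masses. -/
lemma sum_abs_mixture_sub_le {F ι : Type} [Fintype F] [Fintype ι] (μ ν : F → ℝ)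
    (R : F → ι → ℝ) (ε : ℝ) (hε0 : 0 ≤ ε) (hμ : ∀ f, 0 ≤ μ f) (hν : ∀ f, 0 ≤ ν f)
    (hR : ∀ f C, 0 ≤ R f C) (hR1 : ∀ f, ∑ C, R f C = 1)
    (hε : ∀ f g, μ f ≠ 0 → ν g ≠ 0 → ∑ C, |R f C - R g C| ≤ ε) :
    ∑ C, |∑ f, μ f * R f C - ∑ f, ν f * R f C| ≤
      ε * ∑ f, μ f + |∑ f, μ f - ∑ f, ν f| := by
  have mass : ∀ ρ : F → ℝ, ∑ C, ∑ f, ρ f * R f C = ∑ f, ρ f := fun ρ => by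
    rw [Finset.sum_comm]
    simp [← Finset.mul_sum, hR1]
  set m := ∑ f, μ f with hm
  set n := ∑ f, ν f with hn
  have hm0 : 0 ≤ m := Finset.sum_nonneg fun f _ => hμ f
  have hn0 : 0 ≤ n := Finset.sum_nonneg fun f _ => hν f
  rcases hn0.eq_or_lt with h0 | hpos
  · have hν0 : ∀ f, ν f = 0 := fun f =>
      (Finset.sum_eq_zero_iff_of_nonneg fun f _ => hν f).1 h0.symm f (Finset.mem_univ f)
    have e : ∑ C, |∑ f, μ f * R f C - ∑ f, ν f * R f C| = m := by
      rw [hm, ← mass μ]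
      refine Finset.sum_congr rfl fun C _ => ?_
      simp only [hν0, zero_mul, Finset.sum_const_zero, sub_zero]
      exact abs_of_nonneg (Finset.sum_nonneg fun f _ => mul_nonneg (hμ f) (hR f C))
    rw [e, ← h0, sub_zero, abs_of_nonneg hm0]
    exact le_add_of_nonneg_left (mul_nonneg hε0 hm0)
  · have key : ∀ C, n * |∑ f, μ f * R f C - ∑ f, ν f * R f C| ≤
        ∑ f, ∑ g, μ f * ν g * |R f C - R g C| + |m - n| * ∑ g, ν g * R g C := fun C => by
      have e : n * (∑ f, μ f * R f C - ∑ f, ν f * R f C) =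
          ∑ f, ∑ g, μ f * ν g * (R f C - R g C) + (m - n) * ∑ g, ν g * R g C := by
        have e1 : ∑ f, ∑ g, μ f * ν g * (R f C - R g C) =
            (∑ f, μ f * R f C) * n - m * ∑ g, ν g * R g C := by
          rw [hm, hn, Finset.sum_mul_sum, Finset.sum_mul_sum, ← Finset.sum_sub_distrib]
          refine Finset.sum_congr rfl fun f _ => ?_
          rw [← Finset.sum_sub_distrib]
          exact Finset.sum_congr rfl fun g _ => by ring
        rw [e1]; ring
      have hs : 0 ≤ ∑ g, ν g * R g C :=
        Finset.sum_nonneg fun g _ => mul_nonneg (hν g) (hR g C)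
      rw [← abs_of_pos hpos, ← abs_mul, abs_of_pos hpos, e]
      refine (abs_add_le _ _).trans (add_le_add ?_ ?_)
      · refine (Finset.abs_sum_le_sum_abs _ _).trans (Finset.sum_le_sum fun f _ => ?_)
        refine (Finset.abs_sum_le_sum_abs _ _).trans (Finset.sum_le_sum fun g _ => ?_)
        rw [abs_mul, abs_of_nonneg (mul_nonneg (hμ f) (hν g))]
      · rw [abs_mul, abs_of_nonneg hs]
    have tot := Finset.sum_le_sum fun C (_ : C ∈ Finset.univ) => key C
    rw [← Finset.mul_sum, Finset.sum_add_distrib, ← Finset.mul_sum, mass, ← hn] at tot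
    have cross : ∑ C, ∑ f, ∑ g, μ f * ν g * |R f C - R g C| ≤ n * (ε * m) := by
      have : n * (ε * m) = ∑ f, ∑ g, μ f * ν g * ε := by
        simp_rw [← Finset.sum_mul, ← Finset.sum_mul_sum]
        ring
      rw [this, Finset.sum_comm]
      refine Finset.sum_le_sum fun f _ => ?_
      rw [Finset.sum_comm]
      refine Finset.sum_le_sum fun g _ => ?_
      rw [← Finset.mul_sum]
      by_cases hf : μ f = 0
      · simp [hf]
      by_cases hg : ν g = 0
      · simp [hg]
      exact mul_le_mul_of_nonneg_left (hε f g hf hg) (mul_nonneg (hμ f) (hν g))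
    refine le_of_mul_le_mul_left ?_ hpos
    linarith

lemma sum_trajProb (M : Canonical Ω) (A : List Bool → ℕ) (x : Ω) (T : ℕ) :
    ∑ f : Fin (T + 1) → Ω, (if f 0 = x then trajProb M A T (extendTraj T f) else 0) = 1 := by
  induction T with
  | zero =>
    rw [← (Equiv.funUnique (Fin 1) Ω).symm.sum_comp]
    simp [trajProb]
  | succ T ih =>
    rw [sum_snoc, ← ih]
    refine Finset.sum_congr rfl fun f _ => ?_
    have h0 : ∀ y, (Fin.snoc f y : Fin (T + 2) → Ω) 0 = f 0 := fun y =>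
      Fin.snoc_castSucc (α := fun _ => Ω) y f 0
    simp only [h0, trajProb_snoc]
    split_ifs
    · rw [← Finset.mul_sum, M.sum_one, mul_one]
    · simp

/-- Weight of the trajectory `f` started at `x`, restricted to trajectories whose sequence of
classes is `c`. -/
noncomputable def classWeight (M : Canonical Ω) (Pt : Partn Ω) (A : List Bool → ℕ) (x : Ω)
    (T : ℕ) (c : Fin (T + 1) → Finset Ω) (f : Fin (T + 1) → Ω) : ℝ :=
  if f 0 = x ∧ ∀ i, Pt.cls (f i) = c i then trajProb M A T (extendTraj T f) else 0

/-- Probability that the sequence of classes visited by the chain started at `x` is `c`. -/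
noncomputable def classSeqProb (M : Canonical Ω) (Pt : Partn Ω) (A : List Bool → ℕ) (x : Ω)
    (T : ℕ) (c : Fin (T + 1) → Finset Ω) : ℝ :=
  ∑ f, classWeight M Pt A x T c f

lemma classWeight_nonneg (M : Canonical Ω) (Pt : Partn Ω) (A : List Bool → ℕ) (x : Ω)
    (T : ℕ) (c : Fin (T + 1) → Finset Ω) (f : Fin (T + 1) → Ω) :
    0 ≤ classWeight M Pt A x T c f := by
  unfold classWeight
  split_ifs
  exacts [trajProb_nonneg M A T _, le_rfl]

lemma classWeight_ne_zero {M : Canonical Ω} {Pt : Partn Ω} {A : List Bool → ℕ} {x : Ω}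
    {T : ℕ} {c : Fin (T + 1) → Finset Ω} {f : Fin (T + 1) → Ω}
    (h : classWeight M Pt A x T c f ≠ 0) (i : Fin (T + 1)) : Pt.cls (f i) = c i := by
  unfold classWeight at h
  split_ifs at h with h'
  · exact h'.2 i
  · exact absurd rfl h

lemma sum_classSeqProb (M : Canonical Ω) (Pt : Partn Ω) (A : List Bool → ℕ) (x : Ω) (T : ℕ) :
    ∑ c, classSeqProb M Pt A x T c = 1 := by
  rw [← sum_trajProb M A x T]
  unfold classSeqProb
  rw [Finset.sum_comm]
  refine Finset.sum_congr rfl fun f _ => ?_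
  rw [Finset.sum_eq_single fun i => Pt.cls (f i)]
  · simp [classWeight]
  · intro c _ hc
    by_contra h
    exact hc (funext fun i => (classWeight_ne_zero h i).symm)
  · simp

lemma obs_eq_decide_cls (M : Canonical Ω) (Pt : Partn Ω) (hsink : Pt.cls M.sink = {M.sink})
    (x : Ω) : M.obs x = decide (Pt.cls x = {M.sink}) := by
  unfold Canonical.obs
  refine decide_eq_decide.2 ⟨fun h => h ▸ hsink, fun h => ?_⟩
  have := Pt.mem_cls x
  rwa [h, Finset.mem_singleton] at this

/-- The time to which the strategy rewinds after `T` steps, read off the sequence of classes. -/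
def rewindTime (M : Canonical Ω) (A : List Bool → ℕ) (T : ℕ) (c : Fin (T + 1) → Finset Ω) : ℕ :=
  T - A ((List.range (T + 1)).map fun i => decide (extendTraj T c i = {M.sink}))

lemma rewindTime_eq (M : Canonical Ω) (Pt : Partn Ω) (hsink : Pt.cls M.sink = {M.sink})
    (A : List Bool → ℕ) (T : ℕ) (c : Fin (T + 1) → Finset Ω) (f : Fin (T + 1) → Ω)
    (h : ∀ i, Pt.cls (f i) = c i) :
    T - A (obsHist M (extendTraj T f) T) = rewindTime M A T c := by
  obtain rfl : (fun i => Pt.cls (f i)) = c := funext h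
  simp only [rewindTime, obsHist, extendTraj_comp, obs_eq_decide_cls M Pt hsink]
  rfl

/-- Probability of moving from `y` to the class `C`. -/
noncomputable def classStep (M : Canonical Ω) (Pt : Partn Ω) (y : Ω) (C : Finset Ω) : ℝ :=
  ∑ w, if Pt.cls w = C then M.P y w else 0

lemma classStep_nonneg (M : Canonical Ω) (Pt : Partn Ω) (y : Ω) (C : Finset Ω) :
    0 ≤ classStep M Pt y C :=
  Finset.sum_nonneg fun w _ => by split_ifs; exacts [M.nonneg _ _, le_rfl]

lemma sum_classStep (M : Canonical Ω) (Pt : Partn Ω) (y : Ω) :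
    ∑ C, classStep M Pt y C = 1 := by
  unfold classStep
  rw [Finset.sum_comm]
  simp [M.sum_one]

lemma classStep_cls (M : Canonical Ω) (Pt : Partn Ω) (y v : Ω) :
    classStep M Pt y (Pt.cls v) = probOf M.P y (Pt.cls v) := by
  unfold classStep probOf
  rw [← Finset.sum_filter]
  refine Finset.sum_congr (Finset.ext fun w => ?_) fun _ _ => rfl
  simp only [Finset.mem_filter, Finset.mem_univ, true_and]
  exact ⟨fun h => h ▸ Pt.mem_cls w, fun h => Pt.cls_eq v w h⟩

lemma sum_abs_classStep_sub (M : Canonical Ω) (Pt : Partn Ω) (x y : Ω) :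
    ∑ C, |classStep M Pt x C - classStep M Pt y C| = 2 * dTVP M.P Pt x y := by
  unfold dTVP
  rw [← mul_assoc, mul_one_div_cancel two_ne_zero, one_mul]
  symm
  rw [← Finset.sum_subset (Finset.subset_univ (Finset.univ.image Pt.cls))]
  · refine Finset.sum_congr rfl fun C hC => ?_
    obtain ⟨v, -, rfl⟩ := Finset.mem_image.1 hC
    rw [classStep_cls, classStep_cls]
  · intro C _ hC
    have h : ∀ w, Pt.cls w ≠ C := fun w hw =>
      hC (Finset.mem_image.2 ⟨w, Finset.mem_univ w, hw⟩)
    simp [classStep, h]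

lemma classSeqProb_snoc (M : Canonical Ω) (Pt : Partn Ω) (hsink : Pt.cls M.sink = {M.sink})
    (A : List Bool → ℕ) (x : Ω) (T : ℕ) (c : Fin (T + 1) → Finset Ω) (C : Finset Ω) :
    classSeqProb M Pt A x (T + 1) (Fin.snoc c C : Fin (T + 2) → Finset Ω) =
      ∑ f, classWeight M Pt A x T c f *
        classStep M Pt (extendTraj T f (rewindTime M A T c)) C := by
  unfold classSeqProb
  rw [sum_snoc]
  refine Finset.sum_congr rfl fun f _ => ?_
  unfold classStep
  rw [Finset.mul_sum]
  refine Finset.sum_congr rfl fun y _ => ?_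
  have h0 : (Fin.snoc f y : Fin (T + 2) → Ω) 0 = f 0 :=
    Fin.snoc_castSucc (α := fun _ => Ω) y f 0
  have hc : (∀ i, Pt.cls ((Fin.snoc f y : Fin (T + 2) → Ω) i) =
      (Fin.snoc c C : Fin (T + 2) → Finset Ω) i) ↔
      (∀ i, Pt.cls (f i) = c i) ∧ Pt.cls y = C := by
    rw [Fin.forall_fin_succ']
    simp only [Fin.snoc_castSucc, Fin.snoc_last]
  unfold classWeight
  simp only [h0, hc, trajProb_snoc]
  by_cases h : f 0 = x ∧ ∀ i, Pt.cls (f i) = c i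
  · rw [rewindTime_eq M Pt hsink A T c f h.2, if_pos h]
    by_cases hy : Pt.cls y = C
    · rw [if_pos ⟨h.1, h.2, hy⟩, if_pos hy]
    · rw [if_neg fun h' => hy h'.2.2, if_neg hy, mul_zero]
  · rw [if_neg h, if_neg fun h' => h ⟨h'.1, h'.2.1⟩, zero_mul]

lemma sum_abs_classSeqProb_sub_le (M : Canonical Ω) (Pt : Partn Ω)
    (hsink : Pt.cls M.sink = {M.sink}) (θ : ℝ)
    (hθ : ∀ x y, Pt.cls x = Pt.cls y → dTVP M.P Pt x y ≤ θ) (a b : Ω)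
    (hab : Pt.cls a = Pt.cls b) (A : List Bool → ℕ) (T : ℕ) :
    ∑ c, |classSeqProb M Pt A a T c - classSeqProb M Pt A b T c| ≤ 2 * T * θ := by
  induction T with
  | zero =>
    have base : ∀ x c, classSeqProb M Pt A x 0 c = if Pt.cls x = c 0 then 1 else 0 := by
      intro x c
      unfold classSeqProb classWeight
      rw [← (Equiv.funUnique (Fin 1) Ω).symm.sum_comp]
      simp [trajProb, ite_and]
    simp [base, hab]
  | succ T ih =>
    rw [sum_snoc]
    have h0 : 0 ≤ 2 * θ :=
      (Finset.sum_nonneg fun _ _ => abs_nonneg _).trans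
        ((sum_abs_classStep_sub M Pt a b).trans_le
          (mul_le_mul_of_nonneg_left (hθ a b hab) zero_le_two))
    have step : ∀ c : Fin (T + 1) → Finset Ω,
        ∑ C, |classSeqProb M Pt A a (T + 1) (Fin.snoc c C : Fin (T + 2) → Finset Ω) -
          classSeqProb M Pt A b (T + 1) (Fin.snoc c C : Fin (T + 2) → Finset Ω)| ≤
        2 * θ * classSeqProb M Pt A a T c +
          |classSeqProb M Pt A a T c - classSeqProb M Pt A b T c| := fun c => by
      simp only [classSeqProb_snoc M Pt hsink]
      refine sum_abs_mixture_sub_le _ _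
        (fun f => classStep M Pt (extendTraj T f (rewindTime M A T c))) _ h0
        (classWeight_nonneg M Pt A a T c) (classWeight_nonneg M Pt A b T c)
        (fun _ => classStep_nonneg M Pt _) (fun _ => sum_classStep M Pt _)
        fun f g hf hg => ?_
      rw [sum_abs_classStep_sub]
      refine mul_le_mul_of_nonneg_left (hθ _ _ ?_) zero_le_two
      exact (classWeight_ne_zero hf _).trans (classWeight_ne_zero hg _).symm
    refine (Finset.sum_le_sum fun c _ => step c).trans ?_
    rw [Finset.sum_add_distrib, ← Finset.mul_sum, sum_classSeqProb]
    push_cast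
    linarith

lemma obsSeqProb_eq_sum (M : Canonical Ω) (Pt : Partn Ω) (hsink : Pt.cls M.sink = {M.sink})
    (A : List Bool → ℕ) (x : Ω) (T : ℕ) (z : Fin (T + 1) → Bool) :
    obsSeqProb M A x T z = ∑ c : Fin (T + 1) → Finset Ω,
      if (fun i => decide (c i = {M.sink})) = z then classSeqProb M Pt A x T c else 0 := by
  have h : ∀ c : Fin (T + 1) → Finset Ω,
      (if (fun i => decide (c i = {M.sink})) = z then classSeqProb M Pt A x T c else 0) =
        ∑ f, if (fun i => decide (c i = {M.sink})) = z then classWeight M Pt A x T c f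
          else 0 := fun c => by
    split_ifs
    · rfl
    · simp
  simp_rw [h]
  rw [Finset.sum_comm]
  refine Finset.sum_congr rfl fun f _ => ?_
  rw [Finset.sum_eq_single fun i => Pt.cls (f i)]
  · simp only [classWeight, obs_eq_decide_cls M Pt hsink, funext_iff, implies_true, and_true]
    rw [← ite_and]
    exact if_congr and_comm rfl rfl
  · intro c _ hc
    by_contra hne
    refine hc (funext fun i => (classWeight_ne_zero (M := M) (A := A) (x := x) ?_ i).symm)
    intro h0
    exact hne (by rw [h0, ite_self])
  · simp

lemma sum_obsSeqProb (M : Canonical Ω) (A : List Bool → ℕ) (x : Ω) (T : ℕ) :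
    ∑ z, obsSeqProb M A x T z = 1 := by
  rw [← sum_trajProb M A x T]
  unfold obsSeqProb
  rw [Finset.sum_comm]
  refine Finset.sum_congr rfl fun f _ => ?_
  rw [Finset.sum_eq_single fun i => M.obs (f i)]
  · simp
  · intro z _ hz
    exact if_neg fun h => hz (funext fun i => (h.2 i).symm)
  · simp

lemma obsTV_le (M : Canonical Ω) (Pt : Partn Ω) (hsink : Pt.cls M.sink = {M.sink}) (θ : ℝ)
    (hθ : ∀ x y, Pt.cls x = Pt.cls y → dTVP M.P Pt x y ≤ θ) (a b : Ω)
    (hab : Pt.cls a = Pt.cls b) (A : List Bool → ℕ) (T : ℕ) :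
    obsTV M A a b T ≤ T * θ := by
  have h := sum_abs_classSeqProb_sub_le M Pt hsink θ hθ a b hab A T
  have h' : ∑ z, |obsSeqProb M A a T z - obsSeqProb M A b T z| ≤
      ∑ c, |classSeqProb M Pt A a T c - classSeqProb M Pt A b T c| := by
    calc ∑ z, |obsSeqProb M A a T z - obsSeqProb M A b T z|
        ≤ ∑ z : Fin (T + 1) → Bool, ∑ c : Fin (T + 1) → Finset Ω,
            if (fun i => decide (c i = {M.sink})) = z then
              |classSeqProb M Pt A a T c - classSeqProb M Pt A b T c| else 0 := by
          refine Finset.sum_le_sum fun z _ => ?_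
          rw [obsSeqProb_eq_sum M Pt hsink, obsSeqProb_eq_sum M Pt hsink,
            ← Finset.sum_sub_distrib]
          refine (Finset.abs_sum_le_sum_abs _ _).trans (Finset.sum_le_sum fun c _ => ?_)
          split_ifs <;> simp
      _ = _ := by
          rw [Finset.sum_comm]
          simp
  unfold obsTV
  linarith

lemma guess_success_le (M : Canonical Ω) (A : List Bool → ℕ) (a b : Ω) (Q : ℕ)
    (guess : (Fin (Q + 1) → Bool) → Bool) :
    (∑ z : Fin (Q + 1) → Bool, if guess z = true then obsSeqProb M A a Q z else 0) +
      (∑ z : Fin (Q + 1) → Bool, if guess z = false then obsSeqProb M A b Q z else 0) ≤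
    1 + obsTV M A a b Q := by
  have h : ∀ z, (if guess z = true then obsSeqProb M A a Q z else 0) +
      (if guess z = false then obsSeqProb M A b Q z else 0) ≤
      (1 / 2) * (obsSeqProb M A a Q z + obsSeqProb M A b Q z) +
        (1 / 2) * |obsSeqProb M A a Q z - obsSeqProb M A b Q z| := fun z => by
    have h1 := le_abs_self (obsSeqProb M A a Q z - obsSeqProb M A b Q z)
    have h2 := neg_abs_le (obsSeqProb M A a Q z - obsSeqProb M A b Q z)
    cases guess z <;> simp <;> linarith
  rw [← Finset.sum_add_distrib]
  refine (Finset.sum_le_sum fun z _ => h z).trans ?_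
  rw [Finset.sum_add_distrib, ← Finset.mul_sum, ← Finset.mul_sum, Finset.sum_add_distrib,
    sum_obsSeqProb, sum_obsSeqProb]
  unfold obsTV
  linarith

theorem stmt_7 {Ω : Type} [Fintype Ω] [DecidableEq Ω] (M : Canonical Ω)
    (Pt : Partn Ω) (hsink : Pt.cls M.sink = {M.sink})
    (θ : ℝ)
    (hθ : IsGreatest {r : ℝ | ∃ x y : Ω, Pt.cls x = Pt.cls y ∧ r = dTVP M.P Pt x y} θ) :
    ∀ a b : Ω, Pt.cls a = Pt.cls b →
      (∀ (A : List Bool → ℕ) (T : ℕ), obsTV M A a b T ≤ (T : ℝ) * θ) ∧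
      (∀ (A : List Bool → ℕ) (Q : ℕ) (guess : (Fin (Q + 1) → Bool) → Bool),
        (1 / 2 : ℝ) *
            ((∑ z : Fin (Q + 1) → Bool, if guess z = true then obsSeqProb M A a Q z else 0) +
              (∑ z : Fin (Q + 1) → Bool, if guess z = false then obsSeqProb M A b Q z else 0)) ≤
          1 / 2 + (Q : ℝ) * θ / 2) := by
  intro a b hab
  have hθ' : ∀ x y, Pt.cls x = Pt.cls y → dTVP M.P Pt x y ≤ θ := fun x y h =>
    hθ.2 ⟨x, y, h, rfl⟩
  refine ⟨obsTV_le M Pt hsink θ hθ' a b hab, fun A Q guess => ?_⟩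
  have h1 := guess_success_le M A a b Q guess
  have h2 := obsTV_le M Pt hsink θ hθ' a b hab A Q
  linarith
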